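/- Let G be an abelian group (not necessarily finitely generated). Then G is absolutely closed in N₂ if and only if for every prime p the quotient group G/G^p is cyclic. -/

import Mathlib

universe u

/-- A group is nilpotent of class at most 2 (lies in `N₂`) if its commutator
subgroup is contained in its center. -/
def IsNil2 (G : Type*) [Group G] : Prop :=
  commutator G ≤ Subgroup.center G

/-- The dominion of a subgroup `B` of `A` in the variety `N₂`: the set of `a ∈ A`
such that any two homomorphisms from `A` to a nil-2 group agreeing on `B` agree at `a`. -/
def Dominion {A : Type u} [Group A] (B : Subgroup A) : Set A :=
  {a | ∀ (C : Type u) [Group C], IsNil2 C →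
    ∀ f g : A →* C, (∀ b ∈ B, f b = g b) → f a = g a}

/-- A group `B` is absolutely closed in `N₂` if for every nil-2 group `A`
containing (a copy of) `B` as a subgroup, the dominion of `B` in `A` is `B`. -/
def IsAbsolutelyClosed (B : Type u) [Group B] : Prop :=
  ∀ (A : Type u) [Group A], IsNil2 A →
    ∀ ι : B →* A, Function.Injective ι →
      Dominion ι.range = (ι.range : Set A)


open scoped commutatorElement

section L0
theorem fg_coords (Q : Type u) [AddCommGroup Q] [AddGroup.FG Q] :
    ∃ (ι : Type) (_ : Fintype ι) (n : ι → ℕ) (e : ι → Q),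
      (∀ x, ∃ a : ι → ℤ, x = ∑ i, a i • e i) ∧ (∀ i, n i • e i = 0) ∧
      (∀ a : ι → ℤ, ∑ i, a i • e i = 0 → ∀ i, (n i : ℤ) ∣ a i) := by
  classical
  obtain ⟨r, ι, hι, p, -, k, ⟨φ⟩⟩ := AddCommGroup.equiv_free_prod_directSum_zmod Q
  let e' : Fin r ⊕ ι → (Fin r →₀ ℤ) × DirectSum ι (fun i => ZMod (p i ^ k i)) :=
    Sum.elim (fun j => (Finsupp.single j 1, 0))
      (fun i => (0, DirectSum.of (fun i => ZMod (p i ^ k i)) i 1))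
  have hsum : ∀ a : Fin r ⊕ ι → ℤ, ∑ i, a i • e' i =
      (∑ j, Finsupp.single j (a (Sum.inl j)),
        ∑ i, DirectSum.of (fun i => ZMod (p i ^ k i)) i ((a (Sum.inr i) : ℤ) : ZMod (p i ^ k i))) := by
    intro a
    rw [Fintype.sum_sum_type]
    ext1
    · simp [e', Prod.fst_sum]
    · simp only [e', Sum.elim_inl, Sum.elim_inr, Prod.snd_add, Prod.snd_sum, Prod.smul_snd,
        smul_zero, Finset.sum_const_zero, zero_add]
      refine Finset.sum_congr rfl fun i _ => ?_
      rw [← map_zsmul]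
      simp
  have hφ : ∀ a : Fin r ⊕ ι → ℤ, φ (∑ i, a i • φ.symm (e' i)) = ∑ i, a i • e' i := by
    intro a; simp [map_sum]
  refine ⟨Fin r ⊕ ι, inferInstance, Sum.elim (fun _ => 0) (fun i => p i ^ k i),
    fun i => φ.symm (e' i), ?_, ?_, ?_⟩
  · intro x
    refine ⟨Sum.elim (fun j => (φ x).1 j) (fun i => ((φ x).2 i).valMinAbs), ?_⟩
    apply φ.injective
    rw [hφ, hsum]
    ext1
    · simp only [Sum.elim_inl]
      exact (Finsupp.univ_sum_single _).symm
    · simp only [Sum.elim_inr, ZMod.coe_valMinAbs]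
      exact (DirectSum.sum_univ_of _).symm
  · rintro (j | i)
    · simp
    · simp only [Sum.elim_inr, e']
      rw [← map_nsmul, map_eq_zero_iff _ φ.symm.injective]
      ext1
      · simp
      · simp only [Prod.smul_snd, Prod.snd_zero]
        rw [← map_nsmul]
        simp [-Nat.cast_pow, nsmul_eq_mul]
  · intro a ha
    have h := hφ a
    rw [ha, map_zero, hsum] at h
    have h1 := congrArg Prod.fst h
    have h2 := congrArg Prod.snd h
    rintro (j | i)
    · have := DFunLike.congr_fun h1 j
      simp [Finsupp.single_apply, Finsupp.finsetSum_apply] at this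
      simp [this]
    · have := congrArg (DirectSum.component ℤ ι (fun i => ZMod (p i ^ k i)) i) h2
      simp only [Sum.elim_inr]
      rw [← ZMod.intCast_zmod_eq_zero_iff_dvd]
      simp only [map_sum, Prod.snd_zero, map_zero] at this
      rw [Finset.sum_eq_single i] at this
      · exact (DirectSum.of_eq_same (β := fun i => ZMod (p i ^ k i)) i _).symm.trans this.symm
      · intro j _ hj
        exact DirectSum.of_eq_of_ne _ _ _ hj.symm
      · simp

end L0

theorem pair_split {Z : Type u} [AddCommGroup Z] (m n : ℕ) (w : Z)
    (h : Nat.lcm m n • w = 0) : ∃ v v' : Z, m • v = 0 ∧ n • v' = 0 ∧ v - v' = w := by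
  rcases Nat.eq_zero_or_pos (Nat.gcd m n) with h0 | hpos
  · rw [Nat.gcd_eq_zero_iff] at h0
    exact ⟨w, 0, by simp [h0.1], by simp, by simp⟩
  · obtain ⟨m', hm⟩ := Nat.gcd_dvd_left m n
    obtain ⟨n', hn⟩ := Nat.gcd_dvd_right m n
    have hb := Nat.gcd_eq_gcd_ab m n
    have hl := Nat.gcd_mul_lcm m n
    set d := Nat.gcd m n with hd
    set α := Nat.gcdA m n
    set β := Nat.gcdB m n
    have h1 : α * m' + β * n' = 1 := by
      have hd0 : (d : ℤ) ≠ 0 := by exact_mod_cast hpos.ne'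
      apply mul_left_cancel₀ hd0
      have e1 : (m : ℤ) = d * m' := by exact_mod_cast hm
      have e2 : (n : ℤ) = d * n' := by exact_mod_cast hn
      rw [e1, e2] at hb
      linear_combination -hb
    have hL1 : Nat.lcm m n = m * n' := by
      apply Nat.eq_of_mul_eq_mul_left hpos
      rw [hl]; conv_lhs => rw [hn]
      ring
    have hL2 : Nat.lcm m n = n * m' := by
      apply Nat.eq_of_mul_eq_mul_left hpos
      rw [hl]; conv_lhs => rw [hm]
      ring
    refine ⟨(β * n') • w, -((α * m') • w), ?_, ?_, ?_⟩
    · rw [← natCast_zsmul, smul_smul, show (m : ℤ) * (β * n') = β * (m * n' : ℕ) by push_cast; ring,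
        ← hL1, mul_smul, natCast_zsmul, h, smul_zero]
    · rw [smul_neg, ← natCast_zsmul, smul_smul,
        show (n : ℤ) * (α * m') = α * (n * m' : ℕ) by push_cast; ring,
        ← hL2, mul_smul, natCast_zsmul, h, smul_zero, neg_zero]
    · rw [sub_neg_eq_add, ← add_smul, add_comm, h1, one_smul]

theorem form_split_fg {E Z : Type u} [AddCommGroup E] [AddCommGroup Z] [AddGroup.FG E]
    (ω : E →+ E →+ Z) (hω : ∀ x, ω x x = 0) (B : AddSubgroup E)
    (H : ∀ (q : ℕ) (x y : E), q • x ∈ B → q • y ∈ B → q • ω x y = 0) :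
    ∃ β : E →+ E →+ Z, (∀ b ∈ B, ∀ y, β b y = 0) ∧ ∀ x y, β x y - β y x = ω x y := by
  classical
  have hanti : ∀ x y, ω x y = - ω y x := by
    intro x y
    have := hω (x + y)
    simp only [map_add, AddMonoidHom.add_apply, hω, zero_add, add_zero] at this
    rw [eq_neg_iff_add_eq_zero, add_comm]; exact this
  have hBB : ∀ b ∈ B, ∀ b' ∈ B, ω b b' = 0 := by
    intro b hb b' hb'
    simpa using H 1 b b' (by simpa using hb) (by simpa using hb')
  obtain ⟨ι, hι, n, e0, hsp, hn, hind⟩ := fg_coords (E ⧸ B)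
  choose e he0 using fun i => QuotientAddGroup.mk_surjective (e0 i)
  have hmk : ∀ a : ι → ℤ, ((∑ i, a i • e i : E) : E ⧸ B) = ∑ i, a i • e0 i := by
    intro a
    rw [← QuotientAddGroup.mk'_apply, map_sum]
    simp [he0]
  have hsp' : ∀ x, ∃ a : ι → ℤ, x - ∑ i, a i • e i ∈ B := by
    intro x
    obtain ⟨a, ha⟩ := hsp (x : E ⧸ B)
    refine ⟨a, ?_⟩
    rw [← QuotientAddGroup.eq_zero_iff, QuotientAddGroup.mk_sub, hmk, ha, sub_self]
  have hind' : ∀ a : ι → ℤ, ∑ i, a i • e i ∈ B → ∀ i, (n i : ℤ) ∣ a i := by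
    intro a ha
    apply hind
    rw [← hmk, QuotientAddGroup.eq_zero_iff]; exact ha
  have hn' : ∀ i, n i • e i ∈ B := by
    intro i
    rw [← QuotientAddGroup.eq_zero_iff, QuotientAddGroup.mk_nsmul, he0, hn]
  have hpair : ∀ k l, ∃ v v' : Z, n k • v = 0 ∧ n l • v' = 0 ∧ v - v' = ω (e k) (e l) := by
    intro k l
    apply pair_split
    apply H
    · obtain ⟨c, hc⟩ := Nat.dvd_lcm_left (n k) (n l)
      rw [hc, mul_comm, mul_smul]; exact B.nsmul_mem (hn' k) c
    · obtain ⟨c, hc⟩ := Nat.dvd_lcm_right (n k) (n l)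
      rw [hc, mul_comm, mul_smul]; exact B.nsmul_mem (hn' l) c
  choose v v' hv hv' hvv using hpair
  obtain ⟨u, hu, huu⟩ : ∃ u : ι → ι → Z, (∀ k l, n k • u k l = 0) ∧
      ∀ k l, u k l - u l k = ω (e k) (e l) := by
    let σ := Fintype.equivFin ι
    refine ⟨fun k l => if σ k < σ l then v k l else if σ l < σ k then v' l k else 0, ?_, ?_⟩
    · intro k l
      dsimp only
      split_ifs
      · exact hv _ _
      · exact hv' _ _
      · simp
    · intro k l
      dsimp only
      rcases lt_trichotomy (σ k) (σ l) with h | h | h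
      · simp [h, h.not_gt, hvv]
      · have : k = l := σ.injective h
        subst this; simp [hω]
      · simp only [h, h.not_gt, if_true, if_false]
        rw [hanti, ← hvv]; abel
  have hdu : ∀ (z : ℤ) k l, (n k : ℤ) ∣ z → z • u k l = 0 := by
    rintro _ k l ⟨c, rfl⟩
    rw [mul_comm, mul_smul, natCast_zsmul, hu, smul_zero]
  let V : (ι → ℤ) → (ι → ℤ) → E → Z := fun a a' y =>
    ω (∑ i, a i • e i) y + ∑ i, ∑ l, (a i * a' l) • u l i
  have hωs : ∀ a a' : ι → ℤ, ω (∑ i, a i • e i) (∑ l, a' l • e l) =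
      ∑ i, ∑ l, (a i * a' l) • ω (e i) (e l) := by
    intro a a'
    simp only [map_sum, map_zsmul, AddMonoidHom.finsetSum_apply, AddMonoidHom.smul_apply,
      mul_smul, Finset.smul_sum]
    rw [Finset.sum_comm]
    refine Finset.sum_congr rfl fun i _ => Finset.sum_congr rfl fun l _ => ?_
    rw [smul_comm]
  have hVadd1 : ∀ a a1 a' y, V (a + a1) a' y = V a a' y + V a1 a' y := by
    intro a a1 a' y
    simp only [V, Pi.add_apply, add_smul, Finset.sum_add_distrib, map_add,
      AddMonoidHom.add_apply, add_mul]
    abel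
  have hVadd2 : ∀ a a' a1' y y', V a (a' + a1') (y + y') = V a a' y + V a a1' y' := by
    intro a a1 a' y y'
    simp only [V, Pi.add_apply, add_smul, Finset.sum_add_distrib, map_add,
      mul_add]
    abel
  have hV1 : ∀ a a' y, ∑ i, a i • e i ∈ B → y - ∑ i, a' i • e i ∈ B → V a a' y = 0 := by
    intro a a' y ha hy
    have h0 := hBB _ ha _ hy
    rw [map_sub, sub_eq_zero] at h0
    simp only [V]
    rw [h0, hωs, ← Finset.sum_add_distrib]
    refine Finset.sum_eq_zero fun i _ => ?_
    rw [← Finset.sum_add_distrib]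
    refine Finset.sum_eq_zero fun l _ => ?_
    rw [← smul_add, ← huu, sub_add_cancel, hdu]
    exact (hind' a ha i).mul_right _
  have hV2 : ∀ a a', ∑ i, a' i • e i ∈ B → V a a' 0 = 0 := by
    intro a a' ha
    simp only [V, map_zero, zero_add]
    refine Finset.sum_eq_zero fun i _ => Finset.sum_eq_zero fun l _ => ?_
    exact hdu _ _ _ ((hind' a' ha l).mul_left _)
  have hVeq : ∀ x y a a1 a' a1', x - ∑ i, a i • e i ∈ B → x - ∑ i, a1 i • e i ∈ B →
      y - ∑ i, a' i • e i ∈ B → y - ∑ i, a1' i • e i ∈ B → V a a' y = V a1 a1' y := by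
    intro x y a a1 a' a1' h1 h2 h3 h4
    have e1 : V a a' y = V (a - a1) a' y + V a1 a' y := by
      rw [← hVadd1, sub_add_cancel]
    have e2 : V a1 a' y = V a1 (a' - a1') 0 + V a1 a1' y := by
      rw [← hVadd2, sub_add_cancel, zero_add]
    rw [e1, e2, hV1 _ _ _ _ h3, hV2, zero_add, zero_add]
    · have := B.sub_mem h4 h3
      simpa [sub_smul, Finset.sum_sub_distrib] using this
    · have := B.sub_mem h2 h1
      simpa [sub_smul, Finset.sum_sub_distrib] using this
  choose c hc using hsp'
  have hcadd : ∀ x x', (x + x') - ∑ i, (c x + c x') i • e i ∈ B := by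
    intro x x'
    have := B.add_mem (hc x) (hc x')
    simp only [Pi.add_apply, add_smul, Finset.sum_add_distrib]
    convert this using 1
    abel
  let β : E →+ E →+ Z := AddMonoidHom.mk' (fun x => AddMonoidHom.mk' (fun y => V (c x) (c y) y)
      (by
        intro y y'
        rw [← hVadd2]
        exact hVeq x (y + y') _ _ _ _ (hc _) (hc _) (hc _) (hcadd _ _)))
      (by
        intro x x'
        ext y
        simp only [AddMonoidHom.mk'_apply, AddMonoidHom.add_apply]
        rw [← hVadd1]
        exact hVeq (x + x') y _ _ _ _ (hc _) (hcadd _ _) (hc _) (hc _))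
  refine ⟨β, ?_, ?_⟩
  · intro b hb y
    change V (c b) (c y) y = 0
    rw [hVeq b y (c b) 0 (c y) (c y) (hc _) (by simpa using hb) (hc _) (hc _)]
    simp [V]
  · intro x y
    change V (c x) (c y) y - V (c y) (c x) x = ω x y
    have hX := hc x
    have hY := hc y
    have hs := hωs (c x) (c y)
    have hbb := hBB _ hX _ hY
    have hs2 : ∑ i, ∑ l, (c x i * c y l) • u l i - ∑ i, ∑ l, (c y i * c x l) • u l i
        = - ω (∑ i, c x i • e i) (∑ l, c y l • e l) := by
      rw [hs, Finset.sum_comm (f := fun i l => (c y i * c x l) • u l i),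
        ← Finset.sum_sub_distrib, ← Finset.sum_neg_distrib]
      refine Finset.sum_congr rfl fun i _ => ?_
      rw [← Finset.sum_sub_distrib, ← Finset.sum_neg_distrib]
      refine Finset.sum_congr rfl fun l _ => ?_
      rw [mul_comm (c y l), ← smul_sub, ← smul_neg, ← huu]
      congr 1; abel
    simp only [V]
    rw [add_sub_add_comm, hs2, hanti (∑ i, c y i • e i) x]
    simp only [map_sub, AddMonoidHom.sub_apply] at hbb
    rw [← sub_eq_zero, ← neg_eq_zero, ← hbb]
    abel

theorem form_split {E Z : Type u} [AddCommGroup E] [AddCommGroup Z]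
    (ω : E →+ E →+ Z) (hω : ∀ x, ω x x = 0) (B : AddSubgroup E)
    (H : ∀ (q : ℕ) (x y : E), q • x ∈ B → q • y ∈ B → q • ω x y = 0) :
    ∃ (D : Type u) (_ : AddCommGroup D) (lam : Z →+ D) (β : E →+ E →+ D),
      Function.Injective lam ∧
      (∀ b ∈ B, ∀ y, β b y = 0) ∧ ∀ x y, β x y - β y x = lam (ω x y) := by
  classical
  have key : ∀ S : Finset E, ∃ β : AddSubgroup.closure (S : Set E) →+
      AddSubgroup.closure (S : Set E) →+ Z,
      (∀ b : AddSubgroup.closure (S : Set E), (b : E) ∈ B → ∀ y, β b y = 0) ∧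
      ∀ x y, β x y - β y x = ω x y := by
    intro S
    obtain ⟨β, h1, h2⟩ := form_split_fg
      ((ω.compl₂ (AddSubgroup.closure (S : Set E)).subtype).comp
        (AddSubgroup.closure (S : Set E)).subtype) (fun x => hω x)
      (B.comap (AddSubgroup.closure (S : Set E)).subtype)
      (fun q x y hx hy => H q x y hx hy)
    exact ⟨β, h1, h2⟩
  choose β h1 h2 using key
  let F : E → E → Finset E → Z := fun x y S =>
    if h : x ∈ AddSubgroup.closure (S : Set E) ∧ y ∈ AddSubgroup.closure (S : Set E) then
      β S ⟨x, h.1⟩ ⟨y, h.2⟩ else 0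
  have hF : ∀ (S : Finset E) x y (hx : x ∈ AddSubgroup.closure (S : Set E))
      (hy : y ∈ AddSubgroup.closure (S : Set E)), F x y S = β S ⟨x, hx⟩ ⟨y, hy⟩ := by
    intro S x y hx hy
    simp only [F]
    rw [dif_pos ⟨hx, hy⟩]
  have hev : ∀ x : E, ∀ᶠ S : Finset E in Filter.atTop, x ∈ AddSubgroup.closure (S : Set E) := by
    intro x
    filter_upwards [Filter.eventually_ge_atTop {x}] with S hS
    exact AddSubgroup.subset_closure (by simpa using hS)
  let γ : E →+ E →+ Filter.Germ (Filter.atTop : Filter (Finset E)) Z :=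
    AddMonoidHom.mk' (fun x => AddMonoidHom.mk' (fun y => ((F x y : Finset E → Z) : Filter.Germ _ Z))
      (by
        intro y y'
        rw [← Filter.Germ.coe_add, Filter.Germ.coe_eq]
        filter_upwards [hev x, hev y, hev y'] with S hx hy hy'
        simp only [Pi.add_apply]
        rw [hF S x _ hx (add_mem hy hy'), hF S x y hx hy, hF S x y' hx hy', ← map_add]
        rfl))
      (by
        intro x x'
        ext y
        simp only [AddMonoidHom.mk'_apply, AddMonoidHom.add_apply]
        rw [← Filter.Germ.coe_add, Filter.Germ.coe_eq]
        filter_upwards [hev x, hev y, hev x'] with S hx hy hx'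
        simp only [Pi.add_apply]
        rw [hF S _ y (add_mem hx hx') hy, hF S x y hx hy, hF S x' y hx' hy,
          ← AddMonoidHom.add_apply, ← map_add]
        rfl)
  refine ⟨Filter.Germ (Filter.atTop : Filter (Finset E)) Z, inferInstance,
    AddMonoidHom.mk' (fun z => ((z : Z) : Filter.Germ _ Z)) (fun _ _ => rfl), γ, ?_, ?_, ?_⟩
  · intro z z' h
    exact Filter.Germ.const_inj.mp h
  · intro b hb y
    change ((F b y : Finset E → Z) : Filter.Germ _ Z) = Filter.Germ.ofFun (l := Filter.atTop) (fun _ : Finset E => (0 : Z))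
    rw [Filter.Germ.coe_eq]
    filter_upwards [hev b, hev y] with S hx hy
    rw [hF S _ _ hx hy]
    exact h1 S _ hb _
  · intro x y
    change ((F x y : Finset E → Z) : Filter.Germ _ Z) - ((F y x : Finset E → Z) : Filter.Germ _ Z)
      = Filter.Germ.ofFun (l := Filter.atTop) (fun _ : Finset E => ω x y)
    rw [← Filter.Germ.coe_sub, Filter.Germ.coe_eq]
    filter_upwards [hev x, hev y] with S hx hy
    simp only [Pi.sub_apply]
    rw [hF S _ _ hx hy, hF S _ _ hy hx]
    exact h2 S _ _

theorem form_cond {E Z : Type u} [AddCommGroup E] [AddCommGroup Z]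
    (ω : E →+ E →+ Z) (hω : ∀ x, ω x x = 0) (B : AddSubgroup E)
    (hBB : ∀ b ∈ B, ∀ b' ∈ B, ω b b' = 0)
    (hcyc : ∀ q : ℕ, 0 < q → ∃ g ∈ B, ∀ b ∈ B, ∃ i : ℤ, ∃ u ∈ B, b = i • g + q • u)
    (q : ℕ) (x y : E) (hx : q • x ∈ B) (hy : q • y ∈ B) : q • ω x y = 0 := by
  rcases Nat.eq_zero_or_pos q with rfl | hq
  · simp
  have hanti : ∀ x y, ω x y = - ω y x := by
    intro x y
    have := hω (x + y)
    simp only [map_add, AddMonoidHom.add_apply, hω, zero_add, add_zero] at this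
    rw [eq_neg_iff_add_eq_zero, add_comm]; exact this
  obtain ⟨g, hg, hgen⟩ := hcyc q hq
  obtain ⟨i, u, hu, hxu⟩ := hgen _ hx
  obtain ⟨j, v, hv, hyv⟩ := hgen _ hy
  have hsm1 : ∀ x y, q • ω x y = ω (q • x) y := fun x y => by
    rw [map_nsmul]; rfl
  have hsm2 : ∀ x y, q • ω x y = ω x (q • y) := fun x y => by
    rw [map_nsmul]
  have hx' : q • (x - u) = i • g := by rw [smul_sub, hxu]; abel
  have hy' : q • (y - v) = j • g := by rw [smul_sub, hyv]; abel
  have hred : q • ω x y = q • ω (x - u) (y - v) := by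
    have a1 : q • ω x v = 0 := by rw [hsm1]; exact hBB _ hx _ hv
    have a2 : q • ω u y = 0 := by rw [hsm2]; exact hBB _ hu _ hy
    simp only [map_sub, AddMonoidHom.sub_apply, smul_sub, a1, a2, hBB u hu v hv, sub_zero]
  rw [hred]
  set x' := x - u
  set y' := y - v
  by_cases hd : Int.gcd i j = 0
  · rw [Int.gcd_eq_zero_iff] at hd
    rw [hsm1, hx', hd.1]; simp
  · obtain ⟨i', hi⟩ := Int.gcd_dvd_left i j
    obtain ⟨j', hj⟩ := Int.gcd_dvd_right i j
    have hb := Int.gcd_eq_gcd_ab i j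
    set d : ℤ := (Int.gcd i j : ℤ) with hd'
    set s := Int.gcdA i j
    set t := Int.gcdB i j
    have h1 : s * i' + t * j' = 1 := by
      have hd0 : d ≠ 0 := by rw [hd']; exact_mod_cast hd
      apply mul_left_cancel₀ hd0
      linear_combination (-1 : ℤ) * hb - s * hi - t * hj
    have hw : q • (i' • y' - j' • x') = 0 := by
      rw [smul_sub, smul_comm, hy', smul_comm q j', hx', smul_smul, smul_smul, ← sub_smul]
      have : i' * j - j' * i = 0 := by
        linear_combination i' * hj - j' * hi
      rw [this, zero_smul]
    have hz : ω (s • x' + t • y') (i' • y' - j' • x') = ω x' y' := by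
      simp only [map_add, map_sub, map_zsmul, AddMonoidHom.add_apply, AddMonoidHom.smul_apply,
        hω, smul_zero, add_zero, zero_add]
      rw [hanti y' x', smul_neg, smul_neg, sub_neg_eq_add, smul_smul, smul_smul, ← add_smul,
        show i' * s + j' * t = 1 by linear_combination h1, one_smul]
    rw [← hz, hsm2, hw, map_zero]

theorem cyc_all {G : Type u} [CommGroup G]
    (h : ∀ p : ℕ, p.Prime → IsCyclic (G ⧸ (powMonoidHom p : G →* G).range)) (q : ℕ) (hq : 0 < q) :
    ∃ g : G, ∀ b : G, ∃ (i : ℤ) (u : G), b = g ^ i * u ^ q := by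
  induction q using Nat.recOnPosPrimePosCoprime with
  | zero => exact absurd hq (lt_irrefl _)
  | one => exact ⟨1, fun b => ⟨0, b, by simp⟩⟩
  | prime_pow p n hp hn =>
    obtain ⟨⟨g0, hg0⟩⟩ := h p hp
    obtain ⟨g, rfl⟩ := QuotientGroup.mk_surjective g0
    have hg : ∀ b : G, ∃ (i : ℤ) (u : G), b = g ^ i * u ^ p := by
      intro b
      obtain ⟨i, hi⟩ := Subgroup.mem_zpowers_iff.mp (hg0 (b : G ⧸ (powMonoidHom p : G →* G).range))
      rw [← QuotientGroup.mk_zpow, QuotientGroup.eq] at hi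
      obtain ⟨u, hu⟩ := hi
      refine ⟨i, u, ?_⟩
      simp only [powMonoidHom_apply] at hu
      rw [hu]; group
    refine ⟨g, ?_⟩
    clear hn hq
    induction n with
    | zero => exact fun b => ⟨0, b, by simp⟩
    | succ k ih =>
      intro b
      obtain ⟨i, u, rfl⟩ := ih b
      obtain ⟨j, v, rfl⟩ := hg u
      refine ⟨i + j * (p ^ k : ℕ), v, ?_⟩
      rw [mul_pow, zpow_add, zpow_mul, zpow_natCast, ← pow_mul v, pow_succ', mul_assoc]
  | coprime a b ha hb hab iha ihb =>
    obtain ⟨g, hg⟩ := iha (by omega)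
    obtain ⟨k, hk⟩ := ihb (by omega)
    have hbz := Nat.gcd_eq_gcd_ab a b
    rw [hab.gcd_eq_one] at hbz
    push_cast at hbz
    set s := Nat.gcdA a b
    set t := Nat.gcdB a b
    refine ⟨g ^ (t * b) * k ^ (s * a), fun x => ?_⟩
    obtain ⟨i, u, hu⟩ := hg x
    obtain ⟨j, v, hv⟩ := hk x
    refine ⟨i + (j - i) * s * a,
      g ^ (- (t * (j - i) * s)) * k ^ (- (s * (i - j) * t)) * u ^ t * v ^ s, ?_⟩
    have hx : x = (g ^ i * u ^ a) ^ (t * b) * (k ^ j * v ^ b) ^ (s * a) := by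
      rw [← hu, ← hv, ← zpow_add, show t * (b : ℤ) + s * a = 1 by linear_combination -hbz, zpow_one]
    have he : i + (j - i) * s * a = j + (i - j) * t * b := by
      linear_combination (i - j) * hbz
    rw [mul_zpow (g ^ (t * (b : ℤ)))]
    conv_rhs => rw [← zpow_mul, ← zpow_mul k]
    rw [show t * (b : ℤ) * (i + (j - i) * s * a) = i * (t * b) + (t * (j - i) * s) * (a * b : ℕ) by
      push_cast; ring]
    rw [he, show s * (a : ℤ) * (j + (i - j) * t * b) = j * (s * a) + (s * (i - j) * t) * (a * b : ℕ) by
      push_cast; ring]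
    conv_lhs => rw [hx]
    simp only [mul_zpow, zpow_add, ← zpow_natCast, ← zpow_mul, zpow_neg, inv_zpow]
    rw [show (a : ℤ) * (t * b) = t * (a * b : ℕ) by push_cast; ring,
      show (b : ℤ) * (s * a) = s * (a * b : ℕ) by push_cast; ring]
    generalize g ^ (i * (t * (b : ℤ))) = X1
    generalize k ^ (j * (s * (a : ℤ))) = X2
    generalize u ^ (t * ((a * b : ℕ) : ℤ)) = X3
    generalize v ^ (s * ((a * b : ℕ) : ℤ)) = X4
    generalize g ^ (t * (j - i) * s * ((a * b : ℕ) : ℤ)) = X5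
    generalize k ^ (s * (i - j) * t * ((a * b : ℕ) : ℤ)) = X6
    have : X1 * X5 * (X2 * X6) * (X5⁻¹ * X6⁻¹ * X3 * X4)
      = (X1 * X3) * (X2 * X4) * (X5 * X5⁻¹) * (X6 * X6⁻¹) := by
      simp only [mul_comm, mul_left_comm, mul_assoc]
    rw [this]; simp

theorem isNil2_iff {A : Type u} [Group A] : IsNil2 A ↔ ∀ x y : A, ⁅x, y⁆ ∈ Subgroup.center A := by
  unfold IsNil2
  rw [commutator_def, Subgroup.commutator_le]
  simp

theorem IsNil2.of_surjective {A C : Type u} [Group A] [Group C] (h : IsNil2 A) (f : A →* C)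
    (hf : Function.Surjective f) : IsNil2 C := by
  rw [isNil2_iff] at h ⊢
  intro x y
  obtain ⟨x, rfl⟩ := hf x
  obtain ⟨y, rfl⟩ := hf y
  rw [← map_commutatorElement, Subgroup.mem_center_iff]
  intro z
  obtain ⟨z, rfl⟩ := hf z
  rw [← map_mul, ← map_mul, Subgroup.mem_center_iff.mp (h x y) z]

instance centerCommGroup (A : Type*) [Group A] : CommGroup (Subgroup.center A) :=
  { (inferInstance : Group (Subgroup.center A)) with
    mul_comm := fun a b => Subtype.ext ((Subgroup.mem_center_iff.mp b.2 a)) }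

/-- The commutator as a bilinear map. -/
def cm {A : Type u} [Group A] (h : IsNil2 A) : A →* A →* Subgroup.center A :=
  MonoidHom.mk' (fun x => MonoidHom.mk' (fun y => ⟨⁅x, y⁆, isNil2_iff.mp h x y⟩)
    (by
      intro y z
      ext
      simp only [Subgroup.coe_mul]
      have h1 := Subgroup.mem_center_iff.mp (isNil2_iff.mp h x z) y
      calc ⁅x, y * z⁆ = ⁅x, y⁆ * (y * ⁅x, z⁆ * y⁻¹) := by
            simp only [commutatorElement_def]; group
        _ = _ := by rw [h1]; group))
    (by
      intro x y
      ext z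
      simp only [MonoidHom.mk'_apply, MonoidHom.mul_apply, Subgroup.coe_mul]
      have h1 := Subgroup.mem_center_iff.mp (isNil2_iff.mp h y z) x
      have h2 := Subgroup.mem_center_iff.mp (isNil2_iff.mp h y z) ⁅x, z⁆
      calc ⁅x * y, z⁆ = (x * ⁅y, z⁆ * x⁻¹) * ⁅x, z⁆ := by
            simp only [commutatorElement_def]; group
        _ = ⁅y, z⁆ * ⁅x, z⁆ := by rw [h1]; group
        _ = _ := h2.symm)

theorem cm_apply {A : Type u} [Group A] (h : IsNil2 A) (x y : A) :
    ((cm h x y : Subgroup.center A) : A) = ⁅x, y⁆ := rfl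

/-- Central extension of `K` by `M` twisted by a bilinear cocycle. -/
@[ext]
structure Tw {K : Type*} {M : Type*} [Group K] [CommGroup M] (c : K →* K →* M) where
  k : K
  m : M

namespace Tw
variable {K : Type*} {M : Type*} [Group K] [CommGroup M] (c : K →* K →* M)

instance : Mul (Tw c) := ⟨fun a b => ⟨a.k * b.k, a.m * b.m * c a.k b.k⟩⟩
instance : One (Tw c) := ⟨⟨1, 1⟩⟩
instance : Inv (Tw c) := ⟨fun a => ⟨a.k⁻¹, a.m⁻¹ * c a.k a.k⟩⟩

@[simp] theorem mul_k (a b : Tw c) : (a * b).k = a.k * b.k := rfl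
@[simp] theorem mul_m (a b : Tw c) : (a * b).m = a.m * b.m * c a.k b.k := rfl
@[simp] theorem one_k : (1 : Tw c).k = 1 := rfl
@[simp] theorem one_m : (1 : Tw c).m = 1 := rfl
@[simp] theorem inv_k (a : Tw c) : (a⁻¹).k = a.k⁻¹ := rfl
@[simp] theorem inv_m (a : Tw c) : (a⁻¹).m = a.m⁻¹ * c a.k a.k := rfl

instance : Group (Tw c) := Group.ofLeftAxioms
  (by
    intro x y z
    ext
    · simp [mul_assoc]
    · simp only [mul_m, mul_k, map_mul, MonoidHom.mul_apply]
      simp only [mul_assoc, mul_comm, mul_left_comm])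
  (by intro x; ext <;> simp)
  (by
    intro x; ext
    · simp
    · simp only [mul_m, inv_m, inv_k, map_inv, MonoidHom.inv_apply, one_m]
      rw [mul_right_comm, mul_assoc, mul_assoc]
      simp)

/-- The projection. -/
def proj : Tw c →* K := MonoidHom.mk' Tw.k (fun _ _ => rfl)

theorem nil2 (h : ∀ x y : K, ⁅x, y⁆ ∈ Subgroup.center K) (x y : Tw c) :
    ⁅x, y⁆ ∈ Subgroup.center (Tw c) := by
  have hk : (⁅x, y⁆ : Tw c).k = ⁅x.k, y.k⁆ := map_commutatorElement (proj c) x y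
  have h1 : c ⁅x.k, y.k⁆ = 1 := by
    rw [map_commutatorElement, commutatorElement_eq_one_iff_mul_comm, mul_comm]
  have h2 : ∀ z, c z ⁅x.k, y.k⁆ = 1 := fun z => by
    rw [map_commutatorElement, commutatorElement_eq_one_iff_mul_comm, mul_comm]
  rw [Subgroup.mem_center_iff]
  intro z
  ext
  · simp only [mul_k, hk]
    exact Subgroup.mem_center_iff.mp (h _ _) _
  · simp only [mul_m, hk, h1, h2, MonoidHom.one_apply, mul_one]
    rw [mul_comm]
end Tw

/-- The cocycle on `A × A` used for the amalgam. -/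
def amCocycle {A M : Type u} [Group A] [CommGroup M] (β : A →* A →* M) : A × A →* A × A →* M :=
  MonoidHom.mk' (fun k => MonoidHom.mk' (fun l => β k.1 l.1 / β k.1 l.2)
    (by
      intro l l'
      simp only [Prod.fst_mul, Prod.snd_mul, map_mul]
      exact mul_div_mul_comm _ _ _ _))
    (by
      intro k k'
      ext l
      simp only [MonoidHom.mk'_apply, Prod.fst_mul, map_mul, MonoidHom.mul_apply]
      exact mul_div_mul_comm _ _ _ _)

theorem amCocycle_apply {A M : Type u} [Group A] [CommGroup M] (β : A →* A →* M) (k l : A × A) :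
    amCocycle β k l = β k.1 l.1 / β k.1 l.2 := rfl

theorem beta_commutator {A M : Type u} [Group A] [CommGroup M] (β : A →* A →* M) {c : A}
    (hc : c ∈ commutator A) : β c = 1 := by
  have : commutator A ≤ β.ker := Abelianization.commutator_subset_ker β
  exact this hc

theorem phi_commutator {A M : Type u} [Group A] [CommGroup M] (φ : A →* M) {c : A}
    (hc : c ∈ commutator A) : φ c = 1 := by
  have : commutator A ≤ φ.ker := Abelianization.commutator_subset_ker φ
  exact this hc

theorem commutatorElement_mem {A : Type u} [Group A] (x y : A) : ⁅x, y⁆ ∈ commutator A := by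
  rw [commutator_def]
  exact Subgroup.commutator_mem_commutator (Subgroup.mem_top x) (Subgroup.mem_top y)

theorem dominion_eq_of_form {A M : Type u} [Group A] [CommGroup M] (hA : IsNil2 A)
    (B : Subgroup A) (lam : Subgroup.center A →* M) (hlam : Function.Injective lam)
    (β : A →* A →* M) (hβ : ∀ b ∈ B, ∀ y, β b y = 1)
    (hβω : ∀ x y, β x y / β y x = lam (cm hA x y)) : Dominion B = (B : Set A) := by
  apply Set.Subset.antisymm
  swap
  · intro b hb C _ _ f g hfg
    exact hfg b hb
  intro a ha
  have hB1 : ∀ b ∈ B, β b = 1 := fun b hb => by ext y; exact hβ b hb y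
  let N : Subgroup (Tw (amCocycle β)) :=
    { carrier := {w | ∃ b ∈ B, ∃ c : Subgroup.center A, (c : A) ∈ commutator A ∧
        w.k = (b * c, 1) ∧ w.m = lam c}
      one_mem' := ⟨1, B.one_mem, 1, by simp, by simp; rfl, by simp⟩
      mul_mem' := by
        rintro w w' ⟨b, hb, c, hc, hk, hm⟩ ⟨b', hb', c', hc', hk', hm'⟩
        refine ⟨b * b', B.mul_mem hb hb', c * c', ?_, ?_, ?_⟩
        · rw [Subgroup.coe_mul]; exact (commutator A).mul_mem hc hc'
        · rw [Tw.mul_k, hk, hk']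
          ext
          · simp only [Prod.fst_mul, Subgroup.coe_mul]
            have := Subgroup.mem_center_iff.mp c.2 b'
            rw [mul_assoc, mul_assoc, ← mul_assoc (c : A), ← this, mul_assoc]
          · simp
        · rw [Tw.mul_m, hk, hm, hm', amCocycle_apply]
          simp [hB1 b hb, beta_commutator β hc]
      inv_mem' := by
        rintro w ⟨b, hb, c, hc, hk, hm⟩
        refine ⟨b⁻¹, B.inv_mem hb, c⁻¹, ?_, ?_, ?_⟩
        · rw [Subgroup.coe_inv]; exact (commutator A).inv_mem hc
        · rw [Tw.inv_k, hk]
          ext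
          · have := Subgroup.mem_center_iff.mp c.2 b
            simp only [Prod.fst_inv, Subgroup.coe_inv, this]
            group
          · simp
        · rw [Tw.inv_m, hk, hm, amCocycle_apply]
          simp [hB1 b hb, beta_commutator β hc] }
  have hN : N.Normal := by
    refine ⟨?_⟩
    rintro n ⟨b, hb, c, hc, hk, hm⟩ w
    have hcomm : ((cm hA b⁻¹ w.k.1 * c : Subgroup.center A) : A) ∈ commutator A := by
      rw [Subgroup.coe_mul]
      exact (commutator A).mul_mem (commutatorElement_mem _ _) hc
    let n' : Tw (amCocycle β) := ⟨(b * (cm hA b⁻¹ w.k.1 * c : Subgroup.center A), 1),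
      lam (cm hA b⁻¹ w.k.1 * c)⟩
    have hn' : n' ∈ N := ⟨b, hb, cm hA b⁻¹ w.k.1 * c, hcomm, rfl, rfl⟩
    have : w * n = n' * w := by
      ext1
      · rw [Tw.mul_k, Tw.mul_k, hk]
        ext
        · simp only [n', Prod.fst_mul, Subgroup.coe_mul, cm_apply, commutatorElement_def]
          have := Subgroup.mem_center_iff.mp c.2 w.k.1
          simp only [mul_assoc]
          rw [← this]
          group
        · simp [n']
      · rw [Tw.mul_m, Tw.mul_m, hk, hm, amCocycle_apply, amCocycle_apply]
        have hn1 : β (b * (cm hA b⁻¹ w.k.1 * c : Subgroup.center A)) = 1 := by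
          rw [map_mul, hB1 b hb, beta_commutator β hcomm, mul_one]
        have hl : lam (cm hA b⁻¹ w.k.1) = β w.k.1 b := by
          rw [← hβω]; simp [hB1 b hb]
        simp only [n', hn1, map_mul lam, hl, map_mul (β w.k.1), phi_commutator (β w.k.1) hc,
          map_one, MonoidHom.one_apply, mul_one, div_one]
        simp only [mul_comm, mul_left_comm]
    rw [this, mul_assoc, mul_inv_cancel, mul_one]
    exact hn'
  have hT : IsNil2 (Tw (amCocycle β)) := by
    rw [isNil2_iff]
    refine Tw.nil2 _ ?_
    intro x y
    rw [Subgroup.mem_center_iff]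
    intro z
    have h1 := Subgroup.mem_center_iff.mp (isNil2_iff.mp hA x.1 y.1) z.1
    have h2 := Subgroup.mem_center_iff.mp (isNil2_iff.mp hA x.2 y.2) z.2
    exact Prod.ext h1 h2
  let f0 : A →* Tw (amCocycle β) := MonoidHom.mk' (fun x => ⟨(1, x), 1⟩) (by
    intro x y
    ext <;> simp [amCocycle_apply])
  let g0 : A →* Tw (amCocycle β) := MonoidHom.mk' (fun x => ⟨(x, x), 1⟩) (by
    intro x y
    ext <;> simp [amCocycle_apply])
  have hfg : ∀ x, (f0 x)⁻¹ * g0 x = ⟨(x, 1), 1⟩ := by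
    intro x
    ext <;> simp [f0, g0, amCocycle_apply]
  have key := ha (Tw (amCocycle β) ⧸ N)
    (hT.of_surjective (QuotientGroup.mk' N) (QuotientGroup.mk'_surjective N))
    ((QuotientGroup.mk' N).comp f0) ((QuotientGroup.mk' N).comp g0) (by
      intro b hb
      simp only [MonoidHom.comp_apply, QuotientGroup.mk'_apply]
      rw [QuotientGroup.eq, hfg]
      exact ⟨b, hb, 1, by simp, by simp, by simp⟩)
  simp only [MonoidHom.comp_apply, QuotientGroup.mk'_apply] at key
  rw [QuotientGroup.eq, hfg] at key
  obtain ⟨b, hb, c, hc, hk, hm⟩ := key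
  have hc1 : c = 1 := by
    apply hlam
    rw [map_one]; exact hm.symm
  have := congrArg Prod.fst hk
  simp only [hc1, Subgroup.coe_one, mul_one] at this
  rw [this]; exact hb

/-- The commutator form on the abelianization. -/
def omegaForm {A : Type u} [Group A] (hA : IsNil2 A) :
    Additive (Abelianization A) →+ Additive (Abelianization A) →+ Additive (Subgroup.center A) :=
  AddMonoidHom.mk' (fun x => MonoidHom.toAdditive
    ((Abelianization.lift ((MonoidHom.mk' (fun φ : A →* Subgroup.center A => Abelianization.lift φ)
      (by intro φ ψ; ext; simp)).comp (cm hA))) x.toMul))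
    (by
      intro x y
      rw [toMul_add, map_mul]
      rfl)

theorem omegaForm_apply {A : Type u} [Group A] (hA : IsNil2 A) (x y : A) :
    omegaForm hA (Additive.ofMul (Abelianization.of x)) (Additive.ofMul (Abelianization.of y)) =
      Additive.ofMul (cm hA x y) := rfl

theorem absClosed_of_cyclic {G : Type u} [CommGroup G]
    (h : ∀ p : ℕ, p.Prime → IsCyclic (G ⧸ (powMonoidHom p : G →* G).range)) :
    IsAbsolutelyClosed G := by
  intro A _ hA ι _
  let j : G →* Abelianization A := Abelianization.of.comp ι
  let Bb : AddSubgroup (Additive (Abelianization A)) := (MonoidHom.toAdditive j).range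
  have hsurj : ∀ x : Additive (Abelianization A), ∃ a : A, x = Additive.ofMul (Abelianization.of a) := by
    intro x
    obtain ⟨a, ha⟩ := QuotientGroup.mk_surjective (Additive.toMul x)
    exact ⟨a, ha.symm⟩
  have hω : ∀ x, omegaForm hA x x = 0 := by
    intro x
    obtain ⟨a, rfl⟩ := hsurj x
    rw [omegaForm_apply, ← ofMul_one]
    congr 1
    ext
    simp [cm_apply]
  have hBB : ∀ b ∈ Bb, ∀ b' ∈ Bb, omegaForm hA b b' = 0 := by
    rintro _ ⟨g, rfl⟩ _ ⟨g', rfl⟩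
    change omegaForm hA (Additive.ofMul (Abelianization.of (ι g.toMul)))
      (Additive.ofMul (Abelianization.of (ι g'.toMul))) = 0
    rw [omegaForm_apply, ← ofMul_one]
    congr 1
    ext
    rw [cm_apply, ← map_commutatorElement, commutatorElement_eq_one_iff_mul_comm.mpr (mul_comm _ _)]
    simp
  have hcyc : ∀ q : ℕ, 0 < q → ∃ g ∈ Bb, ∀ b ∈ Bb, ∃ i : ℤ, ∃ u ∈ Bb, b = i • g + q • u := by
    intro q hq
    obtain ⟨g, hg⟩ := cyc_all h q hq
    refine ⟨MonoidHom.toAdditive j (Additive.ofMul g), ⟨_, rfl⟩, ?_⟩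
    rintro _ ⟨b, rfl⟩
    obtain ⟨i, u, hu⟩ := hg b.toMul
    refine ⟨i, MonoidHom.toAdditive j (Additive.ofMul u), ⟨_, rfl⟩, ?_⟩
    rw [← map_zsmul, ← map_nsmul, ← map_add]
    congr 1
  obtain ⟨D, _, lam, β, hlam, hβ, hβω⟩ := form_split (omegaForm hA) hω Bb
    (form_cond (omegaForm hA) hω Bb hBB hcyc)
  let βm : A →* A →* Multiplicative D := MonoidHom.mk' (fun x => MonoidHom.mk' (fun y =>
      Multiplicative.ofAdd (β (Additive.ofMul (Abelianization.of x))
        (Additive.ofMul (Abelianization.of y))))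
      (by intro y y'; rw [map_mul, ofMul_mul, map_add, ofAdd_add]))
      (by
        intro x x'
        ext y
        simp only [MonoidHom.mk'_apply, MonoidHom.mul_apply]
        rw [map_mul, ofMul_mul, map_add, AddMonoidHom.add_apply, ofAdd_add])
  let lamm : Subgroup.center A →* Multiplicative D := MonoidHom.mk'
    (fun z => Multiplicative.ofAdd (lam (Additive.ofMul z)))
    (by intro z z'; rw [ofMul_mul, map_add, ofAdd_add])
  refine dominion_eq_of_form hA ι.range lamm ?_ βm ?_ ?_
  · intro z z' hz
    exact hlam hz
  · rintro _ ⟨g, rfl⟩ y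
    exact congrArg Multiplicative.ofAdd (hβ _ ⟨Additive.ofMul g, rfl⟩ _)
  · intro x y
    exact congrArg Multiplicative.ofAdd (hβω (Additive.ofMul (Abelianization.of x))
      (Additive.ofMul (Abelianization.of y)))


theorem commutator_pow_mem_dominion {A : Type u} [Group A] (B : Subgroup A)
    (x y : A) (q : ℕ) (hx : x ^ q ∈ B) (hy : y ^ q ∈ B) : ⁅x, y⁆ ^ q ∈ Dominion B := by
  intro C _ hC f g hfg
  have e1 : ∀ u v : C, ⁅u, v⁆ ^ q = ⁅u ^ q, v⁆ := by
    intro u v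
    rw [← cm_apply hC, ← cm_apply hC, map_pow]
    rfl
  have e2 : ∀ u v : C, ⁅u, v⁆ ^ q = ⁅u, v ^ q⁆ := by
    intro u v
    rw [← cm_apply hC, ← cm_apply hC, map_pow]
    rfl
  have hfx := hfg _ hx
  have hfy := hfg _ hy
  rw [map_pow, map_pow] at hfx hfy
  rw [map_pow, map_pow, map_commutatorElement, map_commutatorElement, e1, hfx, ← e1, e2, hfy, ← e2]

theorem dual_pair {K V : Type*} [Field K] [AddCommGroup V] [Module K V] (a b : V)
    (hli : LinearIndependent K ![a, b]) :
    ∃ L₁ L₂ : V →+ K, L₁ a = 1 ∧ L₁ b = 0 ∧ L₂ a = 0 ∧ L₂ b = 1 := by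
  obtain ⟨L, hL⟩ : ∃ L : V →ₗ[K] (Fin 2 → K),
      L ∘ₗ (Fintype.linearCombination K ![a, b]) = LinearMap.id :=
    LinearMap.exists_leftInverse_of_injective _
      (LinearMap.ker_eq_bot.mpr (hli.fintypeLinearCombination_injective))
  have hLa : L a = Pi.single 0 1 := by
    have := LinearMap.congr_fun hL (Pi.single 0 1)
    simpa [Fintype.linearCombination_apply_single] using this
  have hLb : L b = Pi.single 1 1 := by
    have := LinearMap.congr_fun hL (Pi.single 1 1)
    simpa [Fintype.linearCombination_apply_single] using this
  refine ⟨((LinearMap.proj 0).comp L).toAddMonoidHom, ((LinearMap.proj 1).comp L).toAddMonoidHom,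
    ?_, ?_, ?_, ?_⟩ <;> simp [hLa, hLb]

theorem exists_indep {G : Type u} [CommGroup G] (p : ℕ) (hp : p.Prime)
    (h : ¬ IsCyclic (G ⧸ (powMonoidHom p : G →* G).range)) :
    ∃ (x y : G) (π₁ π₂ : Additive G →+ ZMod p), π₁ (Additive.ofMul x) = 1 ∧
      π₁ (Additive.ofMul y) = 0 ∧ π₂ (Additive.ofMul x) = 0 ∧ π₂ (Additive.ofMul y) = 1 := by
  classical
  have : Fact p.Prime := ⟨hp⟩
  set Q := G ⧸ (powMonoidHom p : G →* G).range with hQ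
  have hpow : ∀ a : Additive Q, p • a = 0 := by
    intro a
    obtain ⟨g, hg⟩ := QuotientGroup.mk_surjective (Additive.toMul a)
    have : (Additive.toMul a) ^ p = 1 := by
      rw [← hg, ← QuotientGroup.mk_pow, QuotientGroup.eq_one_iff]
      exact ⟨g, rfl⟩
    exact this
  let : Module (ZMod p) (Additive Q) := AddCommGroup.zmodModule hpow
  have hzs : ∀ (k : ℤ) (a : Additive Q), (k : ZMod p) • a = k • a := fun k a =>
    Int.cast_smul_eq_zsmul (ZMod p) k a
  have hex : ∀ a : Additive Q, ∃ b : Additive Q, ∀ k : ZMod p, k • a ≠ b := by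
    intro a
    by_contra hcon
    push Not at hcon
    apply h
    refine ⟨Additive.toMul a, fun b => ?_⟩
    obtain ⟨k, hk⟩ := hcon (Additive.ofMul b)
    obtain ⟨k, rfl⟩ := ZMod.intCast_surjective k
    rw [hzs] at hk
    exact ⟨k, hk⟩
  obtain ⟨a, ha⟩ := hex 0
  have ha0 : a ≠ 0 := by
    intro h0
    exact ha 0 (by simp [h0])
  obtain ⟨b, hb⟩ := hex a
  have hli : LinearIndependent (ZMod p) ![a, b] := (LinearIndependent.pair_iff' ha0).mpr hb
  obtain ⟨L₁, L₂, h1, h2, h3, h4⟩ := dual_pair a b hli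
  obtain ⟨x, hx⟩ := QuotientGroup.mk_surjective (Additive.toMul a)
  obtain ⟨y, hy⟩ := QuotientGroup.mk_surjective (Additive.toMul b)
  let P : Additive G →+ Additive Q :=
    MonoidHom.toAdditive (QuotientGroup.mk' (powMonoidHom p : G →* G).range)
  have hPx : P (Additive.ofMul x) = a := hx
  have hPy : P (Additive.ofMul y) = b := hy
  refine ⟨x, y, L₁.comp P, L₂.comp P, ?_, ?_, ?_, ?_⟩
  · rw [AddMonoidHom.comp_apply, hPx, h1]
  · rw [AddMonoidHom.comp_apply, hPy, h2]
  · rw [AddMonoidHom.comp_apply, hPx, h3]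
  · rw [AddMonoidHom.comp_apply, hPy, h4]

/-- The Heisenberg cocycle. -/
def heisCocycle (R : Type) [CommRing R] :
    Multiplicative (R × R) →* Multiplicative (R × R) →* Multiplicative R :=
  MonoidHom.mk' (fun a => MonoidHom.mk' (fun b => Multiplicative.ofAdd (a.toAdd.1 * b.toAdd.2))
    (by intro b b'; rw [← ofAdd_add, toAdd_mul, Prod.snd_add, mul_add]))
    (by
      intro a a'
      refine MonoidHom.ext fun b => ?_
      simp only [MonoidHom.mk'_apply, MonoidHom.mul_apply]
      rw [← ofAdd_add, toAdd_mul, Prod.fst_add, add_mul])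

theorem heisCocycle_apply (R : Type) [CommRing R] (a b : Multiplicative (R × R)) :
    heisCocycle R a b = Multiplicative.ofAdd (a.toAdd.1 * b.toAdd.2) := rfl

theorem exists_mulP (p : ℕ) : ∃ μ : ZMod p →+ ZMod (p ^ 2), μ 1 = (p : ZMod (p ^ 2)) ∧
    ∀ a b, μ a * μ b = 0 := by
  have hpp : (p : ZMod (p ^ 2)) * p = 0 := by
    have := ZMod.natCast_self (p ^ 2)
    rw [pow_two, Nat.cast_mul, ← pow_two] at this
    exact this
  let φ : ℤ →+ ZMod (p ^ 2) := zmultiplesHom _ (p : ZMod (p ^ 2))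
  have hφ : ∀ k : ℤ, φ k = k * p := by intro k; simp [φ]
  let μ : ZMod p →+ ZMod (p ^ 2) := ZMod.lift p ⟨φ, by rw [hφ]; simpa using hpp⟩
  have hμ : ∀ k : ℤ, μ k = k * p := by
    intro k
    rw [← hφ]
    exact ZMod.lift_coe p _ k
  refine ⟨μ, by simpa using hμ 1, ?_⟩
  intro a b
  obtain ⟨a, rfl⟩ := ZMod.intCast_surjective a
  obtain ⟨b, rfl⟩ := ZMod.intCast_surjective b
  rw [hμ, hμ, mul_mul_mul_comm, hpp, mul_zero]

theorem exists_divisible (G : Type u) [CommGroup G] : ∃ (E : Type u) (_ : CommGroup E)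
    (j : G →* E), Function.Injective j ∧ ∀ (q : ℕ), q ≠ 0 → ∀ x : E, ∃ r, r ^ q = x := by
  let E0 := CharacterModule (Additive G) → AddCircle (1 : ℚ)
  let j : G →* Multiplicative E0 := MonoidHom.mk'
    (fun g => Multiplicative.ofAdd (fun χ => χ (Additive.ofMul g)))
    (by
      intro g h
      rw [← ofAdd_add]
      congr 1
      funext χ
      exact map_add χ _ _)
  refine ⟨Multiplicative E0, inferInstance, j, ?_, ?_⟩
  · rw [injective_iff_map_eq_one]
    intro g hg
    have : Additive.ofMul g = 0 := CharacterModule.eq_zero_of_character_apply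
      (fun χ => congrFun (congrArg Multiplicative.toAdd hg) χ)
    exact this
  · intro q hq x
    refine ⟨Multiplicative.ofAdd (fun χ => DivisibleBy.div (Multiplicative.toAdd x χ) (q : ℤ)), ?_⟩
    rw [← ofAdd_nsmul]
    apply Multiplicative.toAdd.injective
    funext χ
    simp only [toAdd_ofAdd]
    have := DivisibleBy.div_cancel (α := ℤ) (Multiplicative.toAdd x χ) (n := (q : ℤ))
      (by exact_mod_cast hq)
    rw [natCast_zsmul] at this
    exact this

theorem cyclic_of_absClosed {G : Type u} [CommGroup G] (h : IsAbsolutelyClosed G) (p : ℕ)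
    (hp : p.Prime) : IsCyclic (G ⧸ (powMonoidHom p : G →* G).range) := by
  by_contra hcon
  obtain ⟨x, y, π₁, π₂, h11, h12, h21, h22⟩ := exists_indep p hp hcon
  obtain ⟨E, _, j, hj, hdiv⟩ := exists_divisible G
  obtain ⟨μ, hμ1, hμ⟩ := exists_mulP p
  let c := heisCocycle (ZMod (p ^ 2))
  let ρ : G →* Tw c := MonoidHom.mk' (fun g =>
      ⟨Multiplicative.ofAdd (μ (π₁ (Additive.ofMul g)), μ (π₂ (Additive.ofMul g))), 1⟩)
    (by
      intro g g'
      ext1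
      · simp only [Tw.mul_k]
        rw [← ofAdd_add, ofMul_mul, map_add, map_add, map_add, map_add]
        rfl
      · simp only [Tw.mul_m, c, heisCocycle_apply, toAdd_ofAdd, hμ]
        simp)
  let ι : G →* E × Tw c := j.prod ρ
  have hι : Function.Injective ι := fun a b hab => hj (congrArg Prod.fst hab)
  have hnT : ∀ x y : Tw c, ⁅x, y⁆ ∈ Subgroup.center (Tw c) := by
    refine Tw.nil2 c ?_
    intro x y
    rw [Subgroup.mem_center_iff]
    intro z
    exact mul_comm _ _
  have hnil : IsNil2 (E × Tw c) := by
    rw [isNil2_iff]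
    intro x y
    rw [Subgroup.mem_center_iff]
    intro z
    exact Prod.ext (mul_comm _ _) (Subgroup.mem_center_iff.mp (hnT x.2 y.2) z.2)
  obtain ⟨r, hr⟩ := hdiv p hp.ne_zero (j x)
  obtain ⟨s, hs⟩ := hdiv p hp.ne_zero (j y)
  let X : Tw c := ⟨Multiplicative.ofAdd (1, 0), 1⟩
  let Y : Tw c := ⟨Multiplicative.ofAdd (0, 1), 1⟩
  have hX : ∀ n : ℕ, X ^ n = ⟨Multiplicative.ofAdd ((n : ZMod (p ^ 2)), 0), 1⟩ := by
    intro n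
    induction n with
    | zero => simp; rfl
    | succ n ih =>
      rw [pow_succ X n, ih]
      ext1
      · simp only [Tw.mul_k, X]
        rw [← ofAdd_add]; simp
      · simp [X, c, heisCocycle_apply]
  have hY : ∀ n : ℕ, Y ^ n = ⟨Multiplicative.ofAdd (0, (n : ZMod (p ^ 2))), 1⟩ := by
    intro n
    induction n with
    | zero => simp; rfl
    | succ n ih =>
      rw [pow_succ Y n, ih]
      ext1
      · simp only [Tw.mul_k, Y]
        rw [← ofAdd_add]; simp
      · simp [Y, c, heisCocycle_apply]
  let W : Tw c := ⟨1, Multiplicative.ofAdd 1⟩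
  have hW : ∀ n : ℕ, W ^ n = ⟨1, Multiplicative.ofAdd (n : ZMod (p ^ 2))⟩ := by
    intro n
    induction n with
    | zero => simp; rfl
    | succ n ih =>
      rw [pow_succ W n, ih]
      ext1
      · simp [W]
      · simp only [Tw.mul_m, W, map_one, mul_one]
        rw [← ofAdd_add]; simp
  have hXY : ⁅X, Y⁆ = W := by
    rw [commutatorElement_def, mul_inv_eq_iff_eq_mul, mul_inv_eq_iff_eq_mul]
    ext1
    · simp [X, Y, W, mul_comm]
    · simp [X, Y, W, c, heisCocycle_apply]
  have hmem := commutator_pow_mem_dominion ι.range (r, X) (s, Y) p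
    ⟨x, by
      refine Prod.ext hr.symm ?_
      change ρ x = X ^ p
      rw [hX]
      simp [ρ, h11, h21, hμ1]⟩
    ⟨y, by
      refine Prod.ext hs.symm ?_
      change ρ y = Y ^ p
      rw [hY]
      simp [ρ, h12, h22, hμ1]⟩
  rw [h (E × Tw c) hnil ι hι] at hmem
  obtain ⟨g, hg⟩ := hmem
  have hg1 : j g = 1 := by
    have h1 := congrArg Prod.fst hg
    change j g = ⁅r, s⁆ ^ p at h1
    rw [h1, commutatorElement_eq_one_iff_mul_comm.mpr (mul_comm _ _), one_pow]
  have hg1' : g = 1 := hj (by rw [hg1, map_one])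
  have h2 : ρ g = ⁅X, Y⁆ ^ p := congrArg Prod.snd hg
  rw [hg1', map_one, hXY, hW] at h2
  have h3 : (p : ZMod (p ^ 2)) = 0 := (congrArg (fun t : Tw c => Multiplicative.toAdd t.m) h2).symm
  rw [ZMod.natCast_eq_zero_iff] at h3
  have := Nat.le_of_dvd hp.pos h3
  nlinarith [hp.two_le]


/-- An abelian group `G` is absolutely closed in `N₂` iff `G/Gᵖ` is cyclic for every
prime `p`. -/
theorem abelian_absolutelyClosed_iff_quotients_cyclic {G : Type u} [CommGroup G] :
    IsAbsolutelyClosed G ↔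
      ∀ p : ℕ, p.Prime → IsCyclic (G ⧸ (powMonoidHom p : G →* G).range) := by
  exact ⟨fun h p hp => cyclic_of_absClosed h p hp, absClosed_of_cyclic⟩
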